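/- Let f be a Hurwitz-type matrix (HTM) polynomial of degree 2m. Then its h-part h and g-part g are right coprime; equivalently (Bézout identity), there exist q×q matrix polynomials X and Y such that X(z)·h(z) + Y(z)·g(z) = I_q for all z ∈ ℂ. -/

import Mathlib

open Matrix MeasureTheory
open scoped ComplexOrder

noncomputable section

/-- The space of `q × q` complex matrices. -/
abbrev Mat (q : ℕ) := Matrix (Fin q) (Fin q) ℂ

/-- The h-part of an even-degree matrix polynomial
`f(z) = A 0 * z^(2m) + ... + A (2m)`:  `h(z) = A 0 * z^m + A 2 * z^(m-1) + ... + A (2m)`. -/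
def hEven (q m : ℕ) (A : ℕ → Mat q) (z : ℂ) : Mat q :=
  ∑ j ∈ Finset.range (m + 1), z ^ (m - j) • A (2 * j)

/-- The g-part of an even-degree matrix polynomial:
`g(z) = A 1 * z^(m-1) + A 3 * z^(m-2) + ... + A (2m-1)`. -/
def gEven (q m : ℕ) (A : ℕ → Mat q) (z : ℂ) : Mat q :=
  ∑ j ∈ Finset.range m, z ^ (m - 1 - j) • A (2 * j + 1)

/-- The h-part of an odd-degree matrix polynomial
`f(z) = A 0 * z^(2m+1) + ... + A (2m+1)`:  `h(z) = A 1 * z^m + ... + A (2m+1)`. -/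
def hOdd (q m : ℕ) (A : ℕ → Mat q) (z : ℂ) : Mat q :=
  ∑ j ∈ Finset.range (m + 1), z ^ (m - j) • A (2 * j + 1)

/-- The g-part of an odd-degree matrix polynomial: `g(z) = A 0 * z^m + ... + A (2m)`. -/
def gOdd (q m : ℕ) (A : ℕ → Mat q) (z : ℂ) : Mat q :=
  ∑ j ∈ Finset.range (m + 1), z ^ (m - j) • A (2 * j)

/-- The matrix polynomial `f(z) = A 0 * z^n + A 1 * z^(n-1) + ... + A n`. -/
def fPoly (q n : ℕ) (A : ℕ → Mat q) (z : ℂ) : Mat q :=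
  ∑ j ∈ Finset.range (n + 1), z ^ (n - j) • A j

/-- Continued fraction for the even case:  `wEven q m c d j z = w_{m-1-j}(z)`, where
`w_{m-1}(z) = z c_{m-1} + d_{m-1}⁻¹` and `w_k(z) = z c_k + (d_k + w_{k+1}(z)⁻¹)⁻¹`. -/
def wEven (q m : ℕ) (c d : ℕ → Mat q) : ℕ → ℂ → Mat q
  | 0, z => z • c (m - 1) + (d (m - 1))⁻¹
  | j + 1, z => z • c (m - 2 - j) + (d (m - 2 - j) + (wEven q m c d j z)⁻¹)⁻¹

/-- Continued fraction for the odd case:  `wOdd q m c d j z = w_{m-1-j}(z)`, where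
`w_{m-1}(z) = z c_{m-1} + (d_{m-1} + z⁻¹ c_m⁻¹)⁻¹`. -/
def wOdd (q m : ℕ) (c d : ℕ → Mat q) : ℕ → ℂ → Mat q
  | 0, z => z • c (m - 1) + (d (m - 1) + z⁻¹ • (c m)⁻¹)⁻¹
  | j + 1, z => z • c (m - 2 - j) + (d (m - 2 - j) + (wOdd q m c d j z)⁻¹)⁻¹

/-- A Hurwitz-type matrix polynomial of degree 2m, described through its h-part and g-part:
there are Hermitian positive definite matrices `c_0, ..., c_{m-1}`, `d_0, ..., d_{m-1}` with
`g(z) h(z)⁻¹ = w_0(z)⁻¹` whenever `det (h z) ≠ 0` and all inverses in the recursion exist. -/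
def IsHTMEven (q m : ℕ) (h g : ℂ → Mat q) : Prop :=
  ∃ c d : ℕ → Mat q,
    (∀ k < m, (c k).PosDef) ∧ (∀ k < m, (d k).PosDef) ∧
    ∀ z : ℂ, (h z).det ≠ 0 →
      (∀ j < m, IsUnit (wEven q m c d j z).det) →
      (∀ j, j + 1 < m → IsUnit (d (m - 2 - j) + (wEven q m c d j z)⁻¹).det) →
      g z * (h z)⁻¹ = (wEven q m c d (m - 1) z)⁻¹

/-- A Hurwitz-type matrix polynomial of degree 2m+1, described through its h-part and g-part:
there are Hermitian positive definite matrices `c_0, ..., c_m`, `d_0, ..., d_{m-1}` with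
`h(z) (z g(z))⁻¹ = w_0(z)⁻¹` whenever `z ≠ 0`, `det (g z) ≠ 0` and all inverses exist. -/
def IsHTMOdd (q m : ℕ) (h g : ℂ → Mat q) : Prop :=
  ∃ c d : ℕ → Mat q,
    (∀ k ≤ m, (c k).PosDef) ∧ (∀ k < m, (d k).PosDef) ∧
    ∀ z : ℂ, z ≠ 0 → (g z).det ≠ 0 →
      IsUnit (d (m - 1) + z⁻¹ • (c m)⁻¹).det →
      (∀ j < m, IsUnit (wOdd q m c d j z).det) →
      (∀ j, j + 1 < m → IsUnit (d (m - 2 - j) + (wOdd q m c d j z)⁻¹).det) →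
      h z * (z • g z)⁻¹ = (wOdd q m c d (m - 1) z)⁻¹

/-- `s_0, ..., s_{2m-1}` are Markov parameters of the even-degree polynomial with
coefficients `A`:  `z^(2m) g(z) - (∑_{j<2m} (-1)^j s_j z^(2m-1-j)) h(z)` has degree ≤ m-1. -/
def MarkovEven (q m : ℕ) (A s : ℕ → Mat q) : Prop :=
  ∃ B : ℕ → Mat q, ∀ z : ℂ,
    z ^ (2 * m) • gEven q m A z
      - (∑ j ∈ Finset.range (2 * m), ((-1 : ℂ) ^ j * z ^ (2 * m - 1 - j)) • s j) * hEven q m A z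
    = ∑ k ∈ Finset.range m, z ^ k • B k

/-- `s_0, ..., s_{2m}` are Markov parameters of the odd-degree polynomial with coefficients
`A`:  `z^(2m+1) h(z) - (∑_{j≤2m} (-1)^j s_j z^(2m-j)) z g(z)` has degree ≤ m. -/
def MarkovOdd (q m : ℕ) (A s : ℕ → Mat q) : Prop :=
  ∃ B : ℕ → Mat q, ∀ z : ℂ,
    z ^ (2 * m + 1) • hOdd q m A z
      - (∑ j ∈ Finset.range (2 * m + 1), ((-1 : ℂ) ^ j * z ^ (2 * m - j)) • s j) *
          (z • gOdd q m A z)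
    = ∑ k ∈ Finset.range (m + 1), z ^ k • B k

/-- The block Hankel matrix `H_{1,n-1} = (s_{i+j})_{i,j=0}^{n-1}` with `n` block rows. -/
def H1b (q : ℕ) (s : ℕ → Mat q) (n : ℕ) : Matrix (Fin n × Fin q) (Fin n × Fin q) ℂ :=
  Matrix.of fun p r => s ((p.1 : ℕ) + (r.1 : ℕ)) p.2 r.2

/-- The block Hankel matrix `H_{2,n-1} = (s_{i+j+1})_{i,j=0}^{n-1}` with `n` block rows. -/
def H2b (q : ℕ) (s : ℕ → Mat q) (n : ℕ) : Matrix (Fin n × Fin q) (Fin n × Fin q) ℂ :=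
  Matrix.of fun p r => s ((p.1 : ℕ) + (r.1 : ℕ) + 1) p.2 r.2

/-- The block column `Y_{1,n} = (s_n; s_{n+1}; ...; s_{2n-1})`. -/
def Y1b (q : ℕ) (s : ℕ → Mat q) (n : ℕ) : Matrix (Fin n × Fin q) (Fin q) ℂ :=
  Matrix.of fun p b => s (n + (p.1 : ℕ)) p.2 b

/-- The block column `Y_{2,n} = (s_{n+1}; ...; s_{2n})`. -/
def Y2b (q : ℕ) (s : ℕ → Mat q) (n : ℕ) : Matrix (Fin n × Fin q) (Fin q) ℂ :=
  Matrix.of fun p b => s (n + 1 + (p.1 : ℕ)) p.2 b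

/-- The block column `col (I, z I, ..., z^(n-1) I)`. -/
def colPow (q n : ℕ) (z : ℂ) : Matrix (Fin n × Fin q) (Fin q) ℂ :=
  Matrix.of fun p b => z ^ (p.1 : ℕ) * (if p.2 = b then 1 else 0)

/-- `r_i(z) = ∑_{k=1}^{i} z^(i-k) s_{k-1}`. -/
def rPol (q : ℕ) (s : ℕ → Mat q) (i : ℕ) (z : ℂ) : Mat q :=
  ∑ k ∈ Finset.range i, z ^ (i - 1 - k) • s k

/-- `t_i(z) = ∑_{k=0}^{i} z^(i-k) s_k`. -/
def tPol (q : ℕ) (s : ℕ → Mat q) (i : ℕ) (z : ℂ) : Mat q :=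
  ∑ k ∈ Finset.range (i + 1), z ^ (i - k) • s k

/-- The block column `col (r_0(z), ..., r_{n-1}(z))`. -/
def colR (q : ℕ) (s : ℕ → Mat q) (n : ℕ) (z : ℂ) : Matrix (Fin n × Fin q) (Fin q) ℂ :=
  Matrix.of fun p b => rPol q s (p.1 : ℕ) z p.2 b

/-- The block column `col (t_0(z), ..., t_{n-1}(z))`. -/
def colT (q : ℕ) (s : ℕ → Mat q) (n : ℕ) (z : ℂ) : Matrix (Fin n × Fin q) (Fin q) ℂ :=
  Matrix.of fun p b => tPol q s (p.1 : ℕ) z p.2 b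

/-- `P_{1,j}(z) = z^j I - Y_{1,j}^* H_{1,j-1}⁻¹ col(I, zI, ..., z^(j-1) I)`. -/
def P1 (q : ℕ) (s : ℕ → Mat q) (j : ℕ) (z : ℂ) : Mat q :=
  z ^ j • (1 : Mat q) - (Y1b q s j)ᴴ * (H1b q s j)⁻¹ * colPow q j z

/-- `P_{2,j}(z) = z^j I - Y_{2,j}^* H_{2,j-1}⁻¹ col(I, zI, ..., z^(j-1) I)`. -/
def P2 (q : ℕ) (s : ℕ → Mat q) (j : ℕ) (z : ℂ) : Mat q :=
  z ^ j • (1 : Mat q) - (Y2b q s j)ᴴ * (H2b q s j)⁻¹ * colPow q j z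

/-- `Q_{1,j}(z) = r_j(z) - Y_{1,j}^* H_{1,j-1}⁻¹ col(r_0(z), ..., r_{j-1}(z))`. -/
def Q1 (q : ℕ) (s : ℕ → Mat q) (j : ℕ) (z : ℂ) : Mat q :=
  rPol q s j z - (Y1b q s j)ᴴ * (H1b q s j)⁻¹ * colR q s j z

/-- `Q_{2,j}(z) = t_j(z) - Y_{2,j}^* H_{2,j-1}⁻¹ col(t_0(z), ..., t_{j-1}(z))`. -/
def Q2 (q : ℕ) (s : ℕ → Mat q) (j : ℕ) (z : ℂ) : Mat q :=
  tPol q s j z - (Y2b q s j)ᴴ * (H2b q s j)⁻¹ * colT q s j z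

/-- The block column `e = (I; 0; ...; 0)` with `n` blocks. -/
def eCol (q n : ℕ) : Matrix (Fin n × Fin q) (Fin q) ℂ :=
  Matrix.of fun p b => if (p.1 : ℕ) = 0 then (if p.2 = b then 1 else 0) else 0

/-- The block column `y = (s_0; s_1; ...; s_{n-1})`. -/
def yCol (q : ℕ) (s : ℕ → Mat q) (n : ℕ) : Matrix (Fin n × Fin q) (Fin q) ℂ :=
  Matrix.of fun p b => s (p.1 : ℕ) p.2 b

/-- Condition C: `A_i^* A_k = A_k^* A_i` for every odd `i` and even `k` with `i, k ≤ n`. -/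
def CondC (q n : ℕ) (A : ℕ → Mat q) : Prop :=
  ∀ i k, i ≤ n → k ≤ n → i % 2 = 1 → k % 2 = 0 → (A i)ᴴ * A k = (A k)ᴴ * A i

/-- The symmetrizer: for a polynomial with (descending) coefficients `Q_0, ..., Q_{n-1}`
(read off as `Q_j = A (2j)`), the `n × n` block Hankel matrix whose `(i,k)` block is
`A (2(n-1-i-k))` if `i + k ≤ n - 1`, and `0` otherwise. -/
def Sh (q n : ℕ) (A : ℕ → Mat q) : Matrix (Fin n × Fin q) (Fin n × Fin q) ℂ :=
  Matrix.of fun p r =>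
    if (p.1 : ℕ) + (r.1 : ℕ) ≤ n - 1 then A (2 * (n - 1 - (p.1 : ℕ) - (r.1 : ℕ))) p.2 r.2
    else 0

/-- The signature matrix `J̃ = diag (I, -I, I, ..., ±I)` with `n` blocks. -/
def Jt (q n : ℕ) : Matrix (Fin n × Fin q) (Fin n × Fin q) ℂ :=
  Matrix.diagonal (fun p => (-1 : ℂ) ^ (p.1 : ℕ))

/-- The block row `(I, x² I, ..., x^(2n-2) I)`. -/
def Rev (q n : ℕ) (x : ℂ) : Matrix (Fin q) (Fin n × Fin q) ℂ :=
  Matrix.of fun a p => x ^ (2 * (p.1 : ℕ)) * (if a = p.2 then 1 else 0)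

/-- The block column `(I; y² I; ...; y^(2n-2) I)`. -/
def Cev (q n : ℕ) (y : ℂ) : Matrix (Fin n × Fin q) (Fin q) ℂ :=
  Matrix.of fun p b => y ^ (2 * (p.1 : ℕ)) * (if p.2 = b then 1 else 0)

/-- The block row `(x I, x³ I, ..., x^(2n-1) I)`. -/
def Rod (q n : ℕ) (x : ℂ) : Matrix (Fin q) (Fin n × Fin q) ℂ :=
  Matrix.of fun a p => x ^ (2 * (p.1 : ℕ) + 1) * (if a = p.2 then 1 else 0)

/-- The block column `(y I; y³ I; ...; y^(2n-1) I)`. -/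
def Cod (q n : ℕ) (y : ℂ) : Matrix (Fin n × Fin q) (Fin q) ℂ :=
  Matrix.of fun p b => y ^ (2 * (p.1 : ℕ) + 1) * (if p.2 = b then 1 else 0)

open Polynomial in
/-- Evaluation of a matrix polynomial at a scalar, as a ring homomorphism. -/
def scalarEval (q : ℕ) (z : ℂ) : (Mat q)[X] →+* Mat q :=
  eval₂RingHom' (RingHom.id _) (Matrix.scalar (Fin q) z)
    fun a => (Matrix.scalar_commute z (fun r => Commute.all z r) a).symm

section ScalarEval

open Polynomial

variable {q : ℕ}

theorem scalarEval_apply (z : ℂ) (p : (Mat q)[X]) :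
    scalarEval q z p = p.eval (Matrix.scalar (Fin q) z) := rfl

@[simp] theorem scalarEval_C (z : ℂ) (a : Mat q) : scalarEval q z (C a) = a := by
  simp [scalarEval_apply]

@[simp] theorem scalarEval_X (z : ℂ) : scalarEval q z X = z • (1 : Mat q) := by
  simp [scalarEval_apply, Matrix.smul_one_eq_diagonal]

theorem scalarEval_monomial (z : ℂ) (n : ℕ) (a : Mat q) :
    scalarEval q z (monomial n a) = z ^ n • a := by
  rw [← C_mul_X_pow_eq_monomial, map_mul, map_pow, scalarEval_C, scalarEval_X, _root_.smul_pow, one_pow,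
    mul_smul_comm, mul_one]

theorem scalarEval_eq_sum (z : ℂ) (p : (Mat q)[X]) {N : ℕ} (hN : p.natDegree ≤ N) :
    scalarEval q z p = ∑ i ∈ Finset.range (N + 1), z ^ i • p.coeff i := by
  conv_lhs => rw [p.as_sum_range' (N + 1) (by omega)]
  simp only [map_sum, scalarEval_monomial]

theorem eq_of_infinite_scalarEval_eq {p r : (Mat q)[X]}
    (h : {z : ℂ | scalarEval q z p = scalarEval q z r}.Infinite) : p = r := by
  apply matPolyEquiv.symm.injective
  ext1 i j
  refine Polynomial.eq_of_infinite_eval_eq _ _ (h.mono fun z hz => ?_)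
  have hz : p.eval (Matrix.scalar (Fin q) z) = r.eval (Matrix.scalar (Fin q) z) := hz
  rw [Set.mem_ofPred_eq, ← matPolyEquiv_eval, ← matPolyEquiv_eval, AlgEquiv.apply_symm_apply,
    AlgEquiv.apply_symm_apply, hz]

/-- The h-part as a matrix polynomial. -/
def hEvenPoly (q m : ℕ) (A : ℕ → Mat q) : (Mat q)[X] :=
  ∑ j ∈ Finset.range (m + 1), monomial (m - j) (A (2 * j))

/-- The g-part as a matrix polynomial. -/
def gEvenPoly (q m : ℕ) (A : ℕ → Mat q) : (Mat q)[X] :=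
  ∑ j ∈ Finset.range m, monomial (m - 1 - j) (A (2 * j + 1))

theorem scalarEval_hEvenPoly (m : ℕ) (A : ℕ → Mat q) (z : ℂ) :
    scalarEval q z (hEvenPoly q m A) = hEven q m A z := by
  simp only [hEvenPoly, hEven, map_sum, scalarEval_monomial]

theorem scalarEval_gEvenPoly (m : ℕ) (A : ℕ → Mat q) (z : ℂ) :
    scalarEval q z (gEvenPoly q m A) = gEven q m A z := by
  simp only [gEvenPoly, gEven, map_sum, scalarEval_monomial]

theorem natDegree_hEvenPoly_le (m : ℕ) (A : ℕ → Mat q) : (hEvenPoly q m A).natDegree ≤ m :=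
  natDegree_sum_le_of_forall_le _ _ fun _ _ => (natDegree_monomial_le _).trans (Nat.sub_le _ _)

theorem coeff_hEvenPoly_self (m : ℕ) (A : ℕ → Mat q) : (hEvenPoly q m A).coeff m = A 0 := by
  rw [hEvenPoly, finsetSum_coeff, Finset.sum_eq_single 0]
  · simp
  · intro j hj hj0
    rw [Finset.mem_range] at hj
    exact coeff_monomial_of_ne _ (by omega)
  · simp

/-- If the leading coefficient of `f` is invertible, then a factor of `f = p * u` of the same
degree as `f` leaves a constant invertible cofactor. -/
theorem exists_isUnit_eq_C_of_mul_eq {R : Type*} [Ring R] [Nontrivial R] {p u f : R[X]} {n : ℕ}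
    (hp : p.natDegree ≤ n) (hpu : IsUnit (p.coeff n)) (hf : f.natDegree ≤ n)
    (hfu : IsUnit (f.coeff n)) (h : p * u = f) : ∃ a : R, IsUnit a ∧ u = C a := by
  have hpn : p.natDegree = n := natDegree_eq_of_le_of_coeff_ne_zero hp hpu.ne_zero
  have hu : u ≠ 0 := by
    rintro rfl
    rw [← h] at hfu
    simp at hfu
  have hlead : p.leadingCoeff * u.leadingCoeff ≠ 0 := by
    rw [leadingCoeff, hpn, Ne, hpu.mul_right_eq_zero]
    exact leadingCoeff_ne_zero.2 hu
  have hdeg := natDegree_mul' hlead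
  rw [h] at hdeg
  have huC : u = C (u.coeff 0) := eq_C_of_natDegree_le_zero (by omega)
  refine ⟨u.coeff 0, ?_, huC⟩
  have hcoeff : p.coeff n * u.coeff 0 = f.coeff n := by
    rw [← h, huC, coeff_mul_C, coeff_C_zero]
  rw [← hcoeff] at hfu
  exact (hpu.mul_left_iff).1 hfu

end ScalarEval

section ContinuedFraction

open Polynomial

variable {q m : ℕ} {c d : ℕ → Mat q}

theorem posDef_wEven (hc : ∀ k < m, (c k).PosDef) (hd : ∀ k < m, (d k).PosDef) {x : ℝ}
    (hx : 0 < x) : ∀ j < m, (wEven q m c d j x).PosDef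
  | 0, hj => ((hc _ (by omega)).smul (Complex.zero_lt_real.2 hx)).add (hd _ (by omega)).inv
  | j + 1, hj => ((hc _ (by omega)).smul (Complex.zero_lt_real.2 hx)).add
      ((hd _ (by omega)).add (posDef_wEven hc hd hx j (by omega)).inv).inv

/-- The continued fraction `wEven q m c d j` is a quotient `P * Q⁻¹` of right coprime matrix
polynomials, where `P` has degree `j + 1` and invertible leading coefficient. -/
theorem exists_coprime_fraction_wEven (hc : ∀ k < m, (c k).PosDef) (hd : ∀ k < m, (d k).PosDef) :
    ∀ j < m, ∃ P Q X Y : (Mat q)[X], X * P + Y * Q = 1 ∧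
      P.natDegree ≤ j + 1 ∧ IsUnit (P.coeff (j + 1)) ∧ Q.natDegree ≤ j ∧
      ∀ x : ℝ, 0 < x →
        scalarEval q x P = wEven q m c d j x * scalarEval q x Q := by
  intro j
  induction j with
  | zero =>
    intro hj
    refine ⟨C (c (m - 1)) * X + C (d (m - 1))⁻¹, 1, 0, 1, by simp, ?_, ?_, by simp, ?_⟩
    · exact natDegree_linear_le
    · simpa [coeff_C] using (hc (m - 1) (by omega)).isUnit
    · intro x hx
      simp [wEven]
  | succ j ih =>
    intro hj
    obtain ⟨P, Q, U, V, hUV, hP, hPu, hQ, hw⟩ := ih (by omega)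
    have hcu := (hc (m - 2 - j) (by omega)).isUnit
    have hdu := (hd (m - 2 - j) (by omega)).isUnit
    set a := c (m - 2 - j)
    set b := d (m - 2 - j)
    have hQdeg : (C b * P + Q).natDegree ≤ j + 1 :=
      natDegree_add_le_of_degree_le ((natDegree_C_mul_le _ _).trans hP) (by omega)
    refine ⟨C a * (C b * P + Q) * X + P, C b * P + Q, U - V * C b,
      V - (U - V * C b) * C a * X, ?_, ?_, ?_, hQdeg, ?_⟩
    · rw [← hUV, mul_add (U - V * C b), sub_mul V, mul_assoc _ X, X_mul]
      simp only [mul_add, sub_mul, add_mul, mul_assoc]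
      abel
    · refine natDegree_add_le_of_degree_le ?_ (by omega)
      refine (natDegree_mul_le).trans (add_le_add ?_ natDegree_X_le)
      exact (natDegree_C_mul_le _ _).trans hQdeg
    · rw [coeff_add, coeff_mul_X, coeff_C_mul, coeff_add, coeff_C_mul,
        coeff_eq_zero_of_natDegree_lt (p := Q) (by omega),
        coeff_eq_zero_of_natDegree_lt (p := P) (n := j + 1 + 1) (by omega), add_zero, add_zero]
      exact hcu.mul (hdu.mul hPu)
    · intro x hx
      have hwpos := posDef_wEven hc hd hx j (by omega)
      have hw₁ := (Matrix.isUnit_iff_isUnit_det _).1 hwpos.isUnit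
      have hsum := (Matrix.isUnit_iff_isUnit_det _).1
        ((hd (m - 2 - j) (by omega)).add hwpos.inv).isUnit
      have hden : b * scalarEval q x P + scalarEval q x Q =
          (b + (wEven q m c d j x)⁻¹) * scalarEval q x P := by
        rw [add_mul, hw x hx, Matrix.nonsing_inv_mul_cancel_left _ _ hw₁]
      simp only [map_add, map_mul, scalarEval_C, scalarEval_X, wEven]
      rw [add_mul (_ • _), hden, Matrix.nonsing_inv_mul_cancel_left _ _ hsum]
      simp [a]

end ContinuedFraction

theorem eventually_det_hEven_ne_zero {q : ℕ} (m : ℕ) {A : ℕ → Mat q} (hA0 : (A 0).det ≠ 0) :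
    ∀ᶠ x : ℝ in Filter.atTop, (hEven q m A x).det ≠ 0 := by
  have hcont : Continuous fun t : ℂ =>
      (∑ j ∈ Finset.range (m + 1), t ^ j • A (2 * j) : Mat q).det := by fun_prop
  have hzero : (∑ j ∈ Finset.range (m + 1), (0 : ℂ) ^ j • A (2 * j) : Mat q).det ≠ 0 := by
    rwa [Finset.sum_range_succ', Finset.sum_eq_zero (by simp), zero_add, pow_zero, one_smul]
  have hlim : Filter.Tendsto (fun x : ℝ => ((x⁻¹ : ℝ) : ℂ)) Filter.atTop (nhds 0) := by
    exact (Complex.continuous_ofReal.tendsto' 0 0 Complex.ofReal_zero).comp tendsto_inv_atTop_zero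
  filter_upwards [hlim.eventually (hcont.continuousAt.eventually_ne hzero),
    Filter.eventually_gt_atTop 0] with x hx hx0
  have hxc : (x : ℂ) ≠ 0 := Complex.ofReal_ne_zero.2 hx0.ne'
  have hh : hEven q m A x =
      (x : ℂ) ^ m • ∑ j ∈ Finset.range (m + 1), ((x⁻¹ : ℝ) : ℂ) ^ j • A (2 * j) := by
    rw [hEven, Finset.smul_sum]
    refine Finset.sum_congr rfl fun j hj => ?_
    rw [Finset.mem_range] at hj
    rw [smul_smul, pow_sub₀ _ hxc (by omega), Complex.ofReal_inv, inv_pow]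
  rw [hh, Matrix.det_smul]
  exact mul_ne_zero (pow_ne_zero _ (pow_ne_zero _ hxc)) hx

theorem stmt_8 (q m : ℕ) (hq : 1 ≤ q) (hm : 1 ≤ m) (A : ℕ → Mat q)
    (hA0 : (A 0).det ≠ 0)
    (hHTM : IsHTMEven q m (hEven q m A) (gEven q m A)) :
    ∃ (N : ℕ) (X Y : ℕ → Mat q), ∀ z : ℂ,
      (∑ i ∈ Finset.range (N + 1), z ^ i • X i) * hEven q m A z
        + (∑ i ∈ Finset.range (N + 1), z ^ i • Y i) * gEven q m A z = 1 := by
  have : NeZero q := ⟨by omega⟩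
  obtain ⟨c, d, hc, hd, hfrac⟩ := hHTM
  obtain ⟨P, Q, X, Y, hXY, hP, hPu, -, hw⟩ :=
    exists_coprime_fraction_wEven hc hd (m - 1) (by omega)
  rw [Nat.sub_add_cancel hm] at hP hPu
  have hfactor : P * (X * hEvenPoly q m A + Y * gEvenPoly q m A) = hEvenPoly q m A := by
    apply eq_of_infinite_scalarEval_eq
    obtain ⟨a, ha⟩ := Filter.eventually_atTop.1
      ((eventually_det_hEven_ne_zero m hA0).and (Filter.eventually_gt_atTop 0))
    refine ((Set.Ici_infinite a).image Complex.ofReal_injective.injOn).mono ?_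
    rintro _ ⟨x, hx, rfl⟩
    obtain ⟨hdet, hx0⟩ := ha x hx
    have hwu : ∀ j < m, IsUnit (wEven q m c d j x).det := fun j hj =>
      (Matrix.isUnit_iff_isUnit_det _).1 (posDef_wEven hc hd hx0 j hj).isUnit
    have hquot := hfrac x hdet hwu fun j hj =>
      (Matrix.isUnit_iff_isUnit_det _).1
        ((hd _ (by omega)).add (posDef_wEven hc hd hx0 j (by omega)).inv).isUnit
    have hQ : scalarEval q x Q =
        gEven q m A x * (hEven q m A x)⁻¹ * scalarEval q x P := by
      rw [hquot, hw x hx0, Matrix.nonsing_inv_mul_cancel_left _ _ (hwu _ (by omega))]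
    have hone : (scalarEval q x X + scalarEval q x Y * (gEven q m A x * (hEven q m A x)⁻¹)) *
        scalarEval q x P = 1 := by
      rw [add_mul, mul_assoc, ← hQ, ← map_mul, ← map_mul, ← map_add, hXY, map_one]
    have hh : scalarEval q x X * hEven q m A x + scalarEval q x Y * gEven q m A x =
        (scalarEval q x X + scalarEval q x Y * (gEven q m A x * (hEven q m A x)⁻¹)) *
          hEven q m A x := by
      rw [add_mul, mul_assoc (scalarEval q x Y),
        Matrix.nonsing_inv_mul_cancel_right _ _ (isUnit_iff_ne_zero.2 hdet)]
    rw [Set.mem_ofPred_eq, map_mul, map_add, map_mul, map_mul, scalarEval_hEvenPoly,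
      scalarEval_gEvenPoly, hh, ← mul_assoc, mul_eq_one_comm.1 hone, one_mul]
  obtain ⟨u, hu, hconst⟩ := exists_isUnit_eq_C_of_mul_eq hP hPu (natDegree_hEvenPoly_le m A)
    (by rw [coeff_hEvenPoly_self]
        exact (Matrix.isUnit_iff_isUnit_det _).2 (isUnit_iff_ne_zero.2 hA0)) hfactor
  obtain ⟨v, hv⟩ := hu.exists_left_inv
  refine ⟨max (Polynomial.C v * X).natDegree (Polynomial.C v * Y).natDegree,
    (Polynomial.C v * X).coeff, (Polynomial.C v * Y).coeff, fun z => ?_⟩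
  rw [← scalarEval_eq_sum z _ (le_max_left _ _), ← scalarEval_eq_sum z _ (le_max_right _ _),
    ← scalarEval_hEvenPoly, ← scalarEval_gEvenPoly, ← map_mul, ← map_mul, ← map_add, mul_assoc,
    mul_assoc, ← mul_add, hconst, ← Polynomial.C_mul, hv, Polynomial.C_1, map_one]

end
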